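/- Let G be a finite simple connected non-bipartite graph, let u and v be vertices of G, and let μ ∈ [0,1) be such that every eigenvalue of the normalized adjacency matrix Â other than the eigenvalue 1 associated to z₁ has absolute value at most μ (i.e., every eigenvalue of Â_r = Â − z₁z₁ᵀ lies in [−μ, μ]). Consider a GNN of depth r with ‖∇φ_l‖ ≤ α and max{‖∇ψ_l‖, 1} ≤ β for all l. Set d_min = min{d_u, d_v} and d_max = max{d_u, d_v}. Then ‖∂h_u^{(r)}/∂x_v‖ ≤ (2αβ)^r · (d_max/2) · ( (2/d_min)·( r + 1 + μ^{r+1}/(1−μ) ) − R_{u,v} ). -/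

import Mathlib

open Matrix Finset

/-- The normalized adjacency matrix `Â = D^{-1/2} A D^{-1/2}` of a graph. -/
noncomputable def nadj {V : Type*} [Fintype V] [DecidableEq V] (G : SimpleGraph V)
    [DecidableRel G.Adj] : Matrix V V ℝ :=
  Matrix.diagonal (fun v => (Real.sqrt (G.degree v))⁻¹) * G.adjMatrix ℝ *
    Matrix.diagonal (fun v => (Real.sqrt (G.degree v))⁻¹)

/-- The unit eigenvector `z₁` of `Â` with eigenvalue `1`: `z₁(v) = √(d_v/(2m))`. -/
noncomputable def zOne {V : Type*} [Fintype V] [DecidableEq V] (G : SimpleGraph V)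
    [DecidableRel G.Adj] : V → ℝ :=
  fun v => Real.sqrt ((G.degree v : ℝ) / (2 * (G.edgeFinset.card : ℝ)))

/-- `Â_r = Â − z₁z₁ᵀ`, the restriction of `Â` to the orthogonal complement of `z₁`. -/
noncomputable def nadjr {V : Type*} [Fintype V] [DecidableEq V] (G : SimpleGraph V)
    [DecidableRel G.Adj] : Matrix V V ℝ :=
  nadj G - Matrix.vecMulVec (zOne G) (zOne G)

/-- The effective resistance `R_{u,v} = (1_u − 1_v)ᵀ (L + (1/n)J)⁻¹ (1_u − 1_v)`. -/
noncomputable def effRes {V : Type*} [Fintype V] [DecidableEq V] (G : SimpleGraph V)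
    [DecidableRel G.Adj] (u v : V) : ℝ :=
  (Pi.single u 1 - Pi.single v 1) ⬝ᵥ
    ((G.lapMatrix ℝ + ((Fintype.card V : ℝ))⁻¹ • Matrix.of (fun _ _ : V => (1 : ℝ)))⁻¹ *ᵥ
      (Pi.single u 1 - Pi.single v 1))

/-- The GNN iteration: `h⁰_v(X) = X v` and
`h^{l+1}_v(X) = φ_l (h^l_v(X), Σ_u Â_{uv} ψ_l (h^l_u(X)))`. -/
noncomputable def gnn {V : Type*} [Fintype V] [DecidableEq V] (G : SimpleGraph V)
    [DecidableRel G.Adj] (d : ℕ)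
    (φ : ℕ → WithLp 2 (EuclideanSpace ℝ (Fin d) × EuclideanSpace ℝ (Fin d)) →
      EuclideanSpace ℝ (Fin d))
    (ψ : ℕ → EuclideanSpace ℝ (Fin d) → EuclideanSpace ℝ (Fin d)) :
    ℕ → (V → EuclideanSpace ℝ (Fin d)) → V → EuclideanSpace ℝ (Fin d)
  | 0, X, v => X v
  | (l + 1), X, v =>
      φ l ((WithLp.equiv 2 _).symm
        (gnn G d φ ψ l X v, ∑ u : V, nadj G u v • ψ l (gnn G d φ ψ l X u)))

section Spectral

variable {V : Type*} [Fintype V]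

lemma dotProduct_le_norm_mul_norm (p q : V → ℝ) :
    p ⬝ᵥ q ≤ ‖WithLp.toLp 2 p‖ * ‖WithLp.toLp 2 q‖ := by
  have h := real_inner_le_norm (WithLp.toLp 2 q) (WithLp.toLp 2 p)
  rw [EuclideanSpace.inner_eq_star_dotProduct] at h
  simpa [mul_comm] using h

lemma dotProduct_self_eq_norm_sq (p : V → ℝ) : p ⬝ᵥ p = ‖WithLp.toLp 2 p‖ ^ 2 := by
  rw [EuclideanSpace.real_norm_sq_eq]
  simp [dotProduct, sq]

/-- A real symmetric matrix whose eigenvalues lie in `[-μ, μ]` has operator norm at most `μ`. -/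
lemma norm_mulVec_le_of_eigenvalues_le [DecidableEq V] {B : Matrix V V ℝ} (hB : B.IsHermitian)
    {μ : ℝ} (hμ : 0 ≤ μ)
    (hspec : ∀ t : ℝ, Module.End.HasEigenvalue (Matrix.mulVecLin B) t → |t| ≤ μ) (p : V → ℝ) :
    ‖WithLp.toLp 2 (B *ᵥ p)‖ ≤ μ * ‖WithLp.toLp 2 p‖ := by
  have heig (i : V) : |hB.eigenvalues i| ≤ μ := by
    refine hspec _ (Module.End.hasEigenvalue_of_hasEigenvector
      (x := ⇑(hB.eigenvectorBasis i)) ⟨?_, ?_⟩)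
    · rw [Module.End.mem_eigenspace_iff, Matrix.mulVecLin_apply]
      exact hB.mulVec_eigenvectorBasis i
    · intro h
      exact hB.eigenvectorBasis.orthonormal.ne_zero i (by ext j; exact congrFun h j)
  have hinner (i : V) : inner ℝ (WithLp.toLp 2 (B *ᵥ p)) (hB.eigenvectorBasis i) =
      hB.eigenvalues i * inner ℝ (WithLp.toLp 2 p) (hB.eigenvectorBasis i) := by
    simp only [EuclideanSpace.inner_eq_star_dotProduct, star_trivial]
    have hT : Bᵀ = B := by simpa using hB.eq
    rw [dotProduct_mulVec, ← mulVec_transpose, hT, hB.mulVec_eigenvectorBasis,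
      smul_dotProduct, smul_eq_mul]
  refine le_of_sq_le_sq ?_ (by positivity)
  rw [mul_pow, ← hB.eigenvectorBasis.sum_sq_inner_left, ← hB.eigenvectorBasis.sum_sq_inner_left,
    Finset.mul_sum]
  refine Finset.sum_le_sum fun i _ => ?_
  rw [hinner, mul_pow]
  exact mul_le_mul_of_nonneg_right (sq_le_sq' (abs_le.1 (heig i)).1 (abs_le.1 (heig i)).2)
    (sq_nonneg _)

/-- Truncation of the Neumann series for `w = (1 - A)⁻¹ x` on the complement of a fixed vector of
a symmetric matrix which is a contraction there. -/
lemma dotProduct_le_sum_pow_add [DecidableEq V] {A : Matrix V V ℝ} (hA : Aᵀ = A) {z : V → ℝ}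
    (hz : A *ᵥ z = z) {μ : ℝ} (hμ0 : 0 ≤ μ) (hμ1 : μ < 1)
    (hcontr : ∀ p, p ⬝ᵥ z = 0 → ‖WithLp.toLp 2 (A *ᵥ p)‖ ≤ μ * ‖WithLp.toLp 2 p‖)
    {w x : V → ℝ} (hw : w ⬝ᵥ z = 0) (hx : w - A *ᵥ w = x) (r : ℕ) :
    x ⬝ᵥ w ≤ ∑ k ∈ range (r + 1), x ⬝ᵥ (A ^ k *ᵥ x) + μ ^ (r + 1) / (1 - μ) * (x ⬝ᵥ x) := by
  have hperp (k : ℕ) : (A ^ k *ᵥ w) ⬝ᵥ z = 0 := by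
    induction k with
    | zero => simpa using hw
    | succ k ih =>
      rw [pow_succ', ← mulVec_mulVec, dotProduct_comm, dotProduct_mulVec, ← mulVec_transpose, hA,
        hz, dotProduct_comm, ih]
  have hdecay (k : ℕ) : ‖WithLp.toLp 2 (A ^ k *ᵥ w)‖ ≤ μ ^ k * ‖WithLp.toLp 2 w‖ := by
    induction k with
    | zero => simp
    | succ k ih =>
      rw [pow_succ', ← mulVec_mulVec, pow_succ', mul_assoc]
      exact (hcontr _ (hperp k)).trans (mul_le_mul_of_nonneg_left ih hμ0)
  have hsum (m : ℕ) : ∑ k ∈ range m, x ⬝ᵥ (A ^ k *ᵥ x) = x ⬝ᵥ w - x ⬝ᵥ (A ^ m *ᵥ w) := by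
    induction m with
    | zero => simp
    | succ m ih =>
      rw [sum_range_succ, ih]
      nth_rw 4 [← hx]
      rw [mulVec_sub, mulVec_mulVec, ← pow_succ, dotProduct_sub]
      ring
  have hwx : (1 - μ) * ‖WithLp.toLp 2 w‖ ≤ ‖WithLp.toLp 2 x‖ := by
    have h1 := norm_sub_norm_le (WithLp.toLp 2 w) (WithLp.toLp 2 (A *ᵥ w))
    rw [← WithLp.toLp_sub, hx] at h1
    linarith [hcontr w hw]
  have htail : x ⬝ᵥ (A ^ (r + 1) *ᵥ w) ≤ μ ^ (r + 1) / (1 - μ) * (x ⬝ᵥ x) := by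
    have h1 : 0 < 1 - μ := by linarith
    calc x ⬝ᵥ (A ^ (r + 1) *ᵥ w)
        ≤ ‖WithLp.toLp 2 x‖ * (μ ^ (r + 1) * ‖WithLp.toLp 2 w‖) :=
          (dotProduct_le_norm_mul_norm _ _).trans
            (mul_le_mul_of_nonneg_left (hdecay _) (norm_nonneg _))
      _ ≤ ‖WithLp.toLp 2 x‖ * (μ ^ (r + 1) * (‖WithLp.toLp 2 x‖ / (1 - μ))) := by
          gcongr
          rwa [le_div_iff₀ h1, mul_comm]
      _ = μ ^ (r + 1) / (1 - μ) * (x ⬝ᵥ x) := by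
          rw [dotProduct_self_eq_norm_sq]; ring
  rw [hsum]
  linarith

/-- A nonnegative matrix with a positive fixed vector has powers with diagonal entries at
most `1`. -/
lemma pow_apply_self_le_one [DecidableEq V] {A : Matrix V V ℝ} (hA : ∀ i j, 0 ≤ A i j)
    {z : V → ℝ} (hpos : ∀ i, 0 < z i) (hz : A *ᵥ z = z) (k : ℕ) (i : V) : (A ^ k) i i ≤ 1 := by
  have hnn : ∀ i j, 0 ≤ (A ^ k) i j := pow_apply_nonneg hA k
  have hk : A ^ k *ᵥ z = z := by
    induction k with
    | zero => simp
    | succ k ih => rw [pow_succ, ← mulVec_mulVec, hz, ih (pow_apply_nonneg hA k)]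
  have h := congrFun hk i
  have h2 : (A ^ k) i i * z i ≤ (A ^ k *ᵥ z) i :=
    single_le_sum (f := fun j => (A ^ k) i j * z j)
      (fun j _ => mul_nonneg (hnn i j) (hpos j).le) (mem_univ i)
  rw [h] at h2
  exact le_of_mul_le_mul_right (by linarith) (hpos i)

lemma one_add_pow_apply_le [DecidableEq V] {A : Matrix V V ℝ} (hA : ∀ i j, 0 ≤ A i j) (r : ℕ)
    (i j : V) : ((1 + A) ^ r) i j ≤ 2 ^ r * ∑ k ∈ range (r + 1), (A ^ k) i j := by
  rw [add_comm, (Commute.one_right A).add_pow, Matrix.sum_apply, mul_sum]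
  refine sum_le_sum fun k _ => ?_
  rw [one_pow, mul_one, ← nsmul_eq_mul', Matrix.smul_apply, nsmul_eq_mul]
  exact mul_le_mul_of_nonneg_right (mod_cast Nat.choose_le_two_pow r k) (pow_apply_nonneg hA k i j)

end Spectral

section Graph

lemma degree_pos {V : Type*} [Fintype V] {G : SimpleGraph V} [DecidableRel G.Adj]
    (hconn : G.Connected) (hcard : 2 ≤ Fintype.card V) (v : V) :
    0 < G.degree v := by
  have : Nontrivial V := Fintype.one_lt_card_iff_nontrivial.1 hcard
  exact hconn.preconnected.degree_pos_of_nontrivial v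

variable {V : Type*} [Fintype V] [DecidableEq V] (G : SimpleGraph V) [DecidableRel G.Adj]

lemma nadj_apply (i j : V) :
    nadj G i j = (√(G.degree i))⁻¹ * G.adjMatrix ℝ i j * (√(G.degree j))⁻¹ := by
  rw [nadj, mul_diagonal, diagonal_mul]

lemma nadj_nonneg (i j : V) : 0 ≤ nadj G i j := by
  rw [nadj_apply, SimpleGraph.adjMatrix_apply]
  split_ifs <;> positivity

lemma nadj_transpose : (nadj G)ᵀ = nadj G := by
  simp [nadj, transpose_mul, Matrix.mul_assoc]

lemma nadjr_isHermitian : (nadjr G).IsHermitian := by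
  ext i j
  have h := congrFun (congrFun (nadj_transpose G) i) j
  rw [transpose_apply] at h
  simp [nadjr, vecMulVec_apply, h, mul_comm]

lemma zOne_eq_smul :
    zOne G = (√(2 * (G.edgeFinset.card : ℝ)))⁻¹ • fun v => √(G.degree v : ℝ) := by
  ext v
  simp [zOne, div_eq_inv_mul]

lemma nadjr_mulVec_of_dotProduct_eq_zero {p : V → ℝ}
    (hp : p ⬝ᵥ (fun v => √(G.degree v : ℝ)) = 0) : nadjr G *ᵥ p = nadj G *ᵥ p := by
  have h : zOne G ⬝ᵥ p = 0 := by
    rw [zOne_eq_smul, smul_dotProduct, dotProduct_comm, hp, smul_zero]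
  rw [nadjr, sub_mulVec, vecMulVec_mulVec, h]
  simp

variable {G}

lemma nadj_mulVec_apply (y : V → ℝ) (hdeg : ∀ v, 0 < G.degree v) (i : V) :
    (nadj G *ᵥ fun v => √(G.degree v : ℝ) * y v) i =
      (√(G.degree i : ℝ))⁻¹ * ∑ j ∈ G.neighborFinset i, y j := by
  rw [← SimpleGraph.adjMatrix_mulVec_apply, mulVec, mulVec, dotProduct, dotProduct, mul_sum]
  refine sum_congr rfl fun j _ => ?_
  have : 0 < √(G.degree j : ℝ) := Real.sqrt_pos.2 (mod_cast hdeg j)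
  rw [nadj_apply]
  field_simp

lemma nadj_mulVec_sqrt_degree (hdeg : ∀ v, 0 < G.degree v) :
    (nadj G *ᵥ fun v => √(G.degree v : ℝ)) = fun v => √(G.degree v : ℝ) := by
  ext i
  have h := nadj_mulVec_apply (fun _ => 1) hdeg i
  simp only [mul_one, sum_const, SimpleGraph.card_neighborFinset_eq_degree, nsmul_eq_mul] at h
  rw [h, inv_mul_eq_div, Real.div_sqrt]

lemma sub_nadj_mulVec_sqrt_degree_mul (y : V → ℝ) (hdeg : ∀ v, 0 < G.degree v) (i : V) :
    √(G.degree i : ℝ) * y i - (nadj G *ᵥ fun v => √(G.degree v : ℝ) * y v) i =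
      (√(G.degree i : ℝ))⁻¹ * (G.lapMatrix ℝ *ᵥ y) i := by
  have h0 : 0 < √(G.degree i : ℝ) := Real.sqrt_pos.2 (mod_cast hdeg i)
  have h1 : √(G.degree i : ℝ) ^ 2 = G.degree i := Real.sq_sqrt (Nat.cast_nonneg _)
  rw [nadj_mulVec_apply y hdeg, SimpleGraph.lapMatrix_mulVec_apply]
  field_simp
  rw [h1]
  ring

lemma sum_lapMatrix_mulVec (y : V → ℝ) : ∑ i, (G.lapMatrix ℝ *ᵥ y) i = 0 := by
  have h : (1 : V → ℝ) ⬝ᵥ (G.lapMatrix ℝ *ᵥ y) = 0 := by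
    rw [dotProduct_mulVec, ← mulVec_transpose, (G.isSymm_lapMatrix (R := ℝ)).eq,
      show (1 : V → ℝ) = fun _ => 1 from rfl, G.lapMatrix_mulVec_const_eq_zero, zero_dotProduct]
  simpa [dotProduct] using h

/-- The effective resistance is the potential difference between `u` and `v` of a potential
inducing a unit current flow from `u` to `v`. -/
lemma exists_potential (hconn : G.Connected) (u v : V) :
    ∃ y : V → ℝ, G.lapMatrix ℝ *ᵥ y = Pi.single u 1 - Pi.single v 1 ∧
      effRes G u v = (Pi.single u 1 - Pi.single v 1) ⬝ᵥ y := by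
  have : Nonempty V := ⟨u⟩
  have hn : (Fintype.card V : ℝ) ≠ 0 := by positivity
  set M : Matrix V V ℝ :=
    G.lapMatrix ℝ + ((Fintype.card V : ℝ))⁻¹ • Matrix.of (fun _ _ : V => (1 : ℝ)) with hM
  have hMy (y : V → ℝ) (i : V) :
      (M *ᵥ y) i = (G.lapMatrix ℝ *ᵥ y) i + (Fintype.card V : ℝ)⁻¹ * ∑ j, y j := by
    rw [hM, add_mulVec, smul_mulVec]
    simp [mulVec, dotProduct]
  have hsum (y : V → ℝ) : ∑ i, (M *ᵥ y) i = ∑ j, y j := by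
    simp_rw [hMy, sum_add_distrib, sum_lapMatrix_mulVec, sum_const, card_univ, nsmul_eq_mul]
    field_simp
    ring
  have hlap {y b : V → ℝ} (hy : M *ᵥ y = b) (hb : ∑ i, b i = 0) : G.lapMatrix ℝ *ᵥ y = b := by
    have h0 := hsum y
    rw [hy, hb] at h0
    ext i
    simpa [← h0, hy] using (hMy y i).symm
  have hunit : IsUnit M := by
    rw [← mulVec_injective_iff_isUnit]
    refine (injective_iff_map_eq_zero M.mulVecLin).2 fun y hy => ?_
    rw [mulVecLin_apply] at hy
    have hconst := G.lapMatrix_mulVec_eq_zero_iff_forall_reachable.1 (hlap hy (by simp))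
    have h0 := hsum y
    rw [hy] at h0
    ext i
    have h1 : ∑ j, y j = Fintype.card V * y i := by
      rw [sum_congr rfl fun j _ => hconst j i (hconn.preconnected j i)]
      simp
    rw [h1] at h0
    simpa [hn] using h0.symm
  refine ⟨M⁻¹ *ᵥ (Pi.single u 1 - Pi.single v 1), hlap ?_ (by simp), rfl⟩
  rw [mulVec_mulVec, Matrix.mul_nonsing_inv _ ((Matrix.isUnit_iff_isUnit_det _).1 hunit),
    one_mulVec]

lemma sum_pow_nadj_le (hconn : G.Connected) (hcard : 2 ≤ Fintype.card V)
    {μ : ℝ} (hμ0 : 0 ≤ μ) (hμ1 : μ < 1)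
    (hspec : ∀ t : ℝ, Module.End.HasEigenvalue (Matrix.mulVecLin (nadjr G)) t → |t| ≤ μ)
    (r : ℕ) (u v : V) :
    2 / (√(G.degree u) * √(G.degree v)) * ∑ k ∈ range (r + 1), (nadj G ^ k) u v ≤
      ((G.degree u : ℝ)⁻¹ + (G.degree v : ℝ)⁻¹) * ((r : ℝ) + 1 + μ ^ (r + 1) / (1 - μ)) -
        effRes G u v := by
  have hdeg := degree_pos hconn hcard
  obtain ⟨y, hy, hR⟩ := exists_potential hconn u v
  set z : V → ℝ := fun v => √(G.degree v : ℝ) with hzdef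
  have hz := nadj_mulVec_sqrt_degree hdeg
  rw [← hzdef] at hz
  have hzpos (i : V) : 0 < z i := Real.sqrt_pos.2 (mod_cast hdeg i)
  have hzsq (i : V) : z i ^ 2 = G.degree i := Real.sq_sqrt (Nat.cast_nonneg _)
  set x : V → ℝ := Pi.single u (z u)⁻¹ - Pi.single v (z v)⁻¹ with hxdef
  have hxi (i : V) : x i = (z i)⁻¹ * ((Pi.single u 1 - Pi.single v 1 : V → ℝ) i) := by
    simp only [hxdef, Pi.sub_apply, Pi.single_apply]
    split_ifs <;> simp_all
  have hxdot (q : V → ℝ) : x ⬝ᵥ q = (z u)⁻¹ * q u - (z v)⁻¹ * q v := by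
    rw [hxdef, sub_dotProduct, single_dotProduct, single_dotProduct]
  have hxz : x ⬝ᵥ z = 0 := by
    rw [hxdot, inv_mul_cancel₀ (hzpos u).ne', inv_mul_cancel₀ (hzpos v).ne', sub_self]
  set w₀ : V → ℝ := fun i => z i * y i with hw₀
  have hw₀x : w₀ - nadj G *ᵥ w₀ = x := by
    ext i
    rw [hxi, ← hy]
    exact sub_nadj_mulVec_sqrt_degree_mul y hdeg i
  have hzz : z ⬝ᵥ z ≠ 0 := by
    have h : 0 < z ⬝ᵥ z := sum_pos (fun i _ => mul_pos (hzpos i) (hzpos i)) ⟨u, mem_univ u⟩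
    exact h.ne'
  set c : ℝ := w₀ ⬝ᵥ z / (z ⬝ᵥ z) with hc
  have key := dotProduct_le_sum_pow_add (nadj_transpose G) hz hμ0 hμ1
    (fun p hp => by
      rw [← nadjr_mulVec_of_dotProduct_eq_zero G hp]
      exact norm_mulVec_le_of_eigenvalues_le (nadjr_isHermitian G) hμ0 hspec p)
    (w := w₀ - c • z) (x := x)
    (by rw [sub_dotProduct, smul_dotProduct, smul_eq_mul, hc, div_mul_cancel₀ _ hzz, sub_self])
    (by rw [mulVec_sub, mulVec_smul, hz, ← hw₀x]; abel) r
  have hxw : x ⬝ᵥ (w₀ - c • z) = effRes G u v := by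
    rw [dotProduct_sub, dotProduct_smul, hxz, smul_zero, sub_zero, hR, hxdot, sub_dotProduct,
      single_dotProduct, single_dotProduct, hw₀]
    simp only [one_mul]
    rw [inv_mul_cancel_left₀ (hzpos u).ne', inv_mul_cancel_left₀ (hzpos v).ne']
  have hquad {B : Matrix V V ℝ} (hB : Bᵀ = B) : x ⬝ᵥ (B *ᵥ x) =
      (G.degree u : ℝ)⁻¹ * B u u + (G.degree v : ℝ)⁻¹ * B v v - 2 / (z u * z v) * B u v := by
    have hvu : B v u = B u v := congrFun (congrFun hB u) v
    have hBx (i : V) : (B *ᵥ x) i = B i u * (z u)⁻¹ - B i v * (z v)⁻¹ := by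
      rw [hxdef, mulVec_sub, Pi.sub_apply]
      simp [mulVec]
    have := hzpos u
    have := hzpos v
    rw [hxdot, hBx, hBx, hvu, ← hzsq, ← hzsq]
    field_simp
    ring
  have hterm (k : ℕ) : x ⬝ᵥ (nadj G ^ k *ᵥ x) ≤
      ((G.degree u : ℝ)⁻¹ + (G.degree v : ℝ)⁻¹) - 2 / (z u * z v) * (nadj G ^ k) u v := by
    rw [hquad (by rw [transpose_pow, nadj_transpose])]
    have hu := mul_le_mul_of_nonneg_left
      (pow_apply_self_le_one (nadj_nonneg G) hzpos hz k u) (inv_nonneg.2 (G.degree u).cast_nonneg)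
    have hv := mul_le_mul_of_nonneg_left
      (pow_apply_self_le_one (nadj_nonneg G) hzpos hz k v) (inv_nonneg.2 (G.degree v).cast_nonneg)
    linarith
  have hsum := sum_le_sum fun k (_ : k ∈ range (r + 1)) => hterm k
  rw [sum_sub_distrib, ← mul_sum, sum_const, card_range, nsmul_eq_mul] at hsum
  push_cast at hsum
  have hxx : x ⬝ᵥ x ≤ (G.degree u : ℝ)⁻¹ + (G.degree v : ℝ)⁻¹ := by
    have h := hterm 0
    have h0 : 0 ≤ 2 / (z u * z v) * (nadj G ^ 0) u v :=
      mul_nonneg (div_nonneg zero_le_two (mul_pos (hzpos u) (hzpos v)).le)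
        (pow_apply_nonneg (nadj_nonneg G) 0 u v)
    rw [pow_zero, one_mulVec] at h
    rw [pow_zero] at h0
    linarith
  have hμ : 0 ≤ μ ^ (r + 1) / (1 - μ) := div_nonneg (by positivity) (by linarith)
  have hlast := mul_le_mul_of_nonneg_left hxx hμ
  rw [hxw] at key
  linarith

end Graph

lemma norm_toLp_prod_le_add {E F : Type*} [NormedAddCommGroup E] [NormedAddCommGroup F]
    (p : WithLp 2 (E × F)) : ‖p‖ ≤ ‖p.fst‖ + ‖p.snd‖ := by
  rw [WithLp.prod_norm_eq_of_L2]
  refine Real.sqrt_le_iff.2 ⟨by positivity, ?_⟩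
  nlinarith [norm_nonneg p.fst, norm_nonneg p.snd]

lemma norm_gnn_update_sub_le {V : Type*} [Fintype V] [DecidableEq V]
    (G : SimpleGraph V) [DecidableRel G.Adj] {d : ℕ}
    {φ : ℕ → WithLp 2 (EuclideanSpace ℝ (Fin d) × EuclideanSpace ℝ (Fin d)) →
      EuclideanSpace ℝ (Fin d)}
    {ψ : ℕ → EuclideanSpace ℝ (Fin d) → EuclideanSpace ℝ (Fin d)} {α β : ℝ}
    (hφ : ∀ l p q, ‖φ l p - φ l q‖ ≤ α * ‖p - q‖) (hψ : ∀ l p q, ‖ψ l p - ψ l q‖ ≤ β * ‖p - q‖)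
    (hα : 0 ≤ α) (hβ : 1 ≤ β) (X : V → EuclideanSpace ℝ (Fin d)) (v : V)
    (y y' : EuclideanSpace ℝ (Fin d)) (l : ℕ) (u : V) :
    ‖gnn G d φ ψ l (Function.update X v y) u - gnn G d φ ψ l (Function.update X v y') u‖ ≤
      (α * β) ^ l * ((1 + nadj G) ^ l) u v * ‖y - y'‖ := by
  induction l generalizing u with
  | zero =>
    rcases eq_or_ne u v with rfl | h
    · simp [gnn]
    · simp [gnn, h]
  | succ l ih =>
    set f := gnn G d φ ψ l (Function.update X v y)
    set g := gnn G d φ ψ l (Function.update X v y')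
    have hmsg : ‖∑ w, nadj G w u • ψ l (f w) - ∑ w, nadj G w u • ψ l (g w)‖ ≤
        β * ∑ w, nadj G u w * ‖f w - g w‖ := by
      rw [← sum_sub_distrib, mul_sum]
      refine (norm_sum_le _ _).trans (sum_le_sum fun w _ => ?_)
      rw [← smul_sub, norm_smul, Real.norm_of_nonneg (nadj_nonneg G w u),
        show nadj G w u = nadj G u w from congrFun (congrFun (nadj_transpose G) u) w, mul_left_comm]
      exact mul_le_mul_of_nonneg_left (hψ l _ _) (nadj_nonneg G u w)
    have hself : ‖f u - g u‖ ≤ β * ‖f u - g u‖ := le_mul_of_one_le_left (norm_nonneg _) hβ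
    calc _ ≤ α * (‖f u - g u‖ +
          ‖∑ w, nadj G w u • ψ l (f w) - ∑ w, nadj G w u • ψ l (g w)‖) :=
          (hφ l (WithLp.toLp 2 (f u, ∑ w, nadj G w u • ψ l (f w)))
            (WithLp.toLp 2 (g u, ∑ w, nadj G w u • ψ l (g w)))).trans
            (mul_le_mul_of_nonneg_left (norm_toLp_prod_le_add _) hα)
      _ ≤ α * (β * (‖f u - g u‖ + ∑ w, nadj G u w * ‖f w - g w‖)) := by
          refine mul_le_mul_of_nonneg_left ?_ hα
          linarith
      _ ≤ α * (β * ((α * β) ^ l * ((1 + nadj G) ^ l) u v * ‖y - y'‖ +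
            ∑ w, nadj G u w * ((α * β) ^ l * ((1 + nadj G) ^ l) w v * ‖y - y'‖))) := by
          gcongr with w
          · exact ih u
          · exact nadj_nonneg G u w
          · exact ih w
      _ = _ := by
          rw [pow_succ' (1 + nadj G), add_mul, one_mul, Matrix.add_apply, Matrix.mul_apply,
            pow_succ (α * β), mul_add, mul_add, mul_add, add_mul, mul_sum, mul_sum, mul_sum,
            sum_mul]
          congr 1
          · ring
          · exact sum_congr rfl fun w _ => by ring

/-- effective-resistance bound on the Jacobian of a GNN. For a connected
non-bipartite graph, if every eigenvalue of `Â_r = Â − z₁z₁ᵀ` lies in `[−μ, μ]` with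
`μ ∈ [0,1)`, `‖∇φ_l‖ ≤ α` and `max {‖∇ψ_l‖, 1} ≤ β`, then
`‖∂h_u^{(r)}/∂x_v‖ ≤ (2αβ)^r · (d_max/2) · ((2/d_min)(r + 1 + μ^{r+1}/(1−μ)) − R_{u,v})`. -/
theorem jacobian_bound_by_effective_resistance {V : Type*} [Fintype V] [DecidableEq V]
    (G : SimpleGraph V) [DecidableRel G.Adj]
    (hconn : G.Connected) (hnonbip : ¬ G.Colorable 2) (hcard : 2 ≤ Fintype.card V)
    (μ : ℝ) (hμ0 : 0 ≤ μ) (hμ1 : μ < 1)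
    (hspec : ∀ t : ℝ, Module.End.HasEigenvalue (Matrix.mulVecLin (nadjr G)) t → |t| ≤ μ)
    (d r : ℕ)
    (φ : ℕ → WithLp 2 (EuclideanSpace ℝ (Fin d) × EuclideanSpace ℝ (Fin d)) →
      EuclideanSpace ℝ (Fin d))
    (ψ : ℕ → EuclideanSpace ℝ (Fin d) → EuclideanSpace ℝ (Fin d))
    (α β : ℝ)
    (hφdiff : ∀ l, ContDiff ℝ 1 (φ l))
    (hψdiff : ∀ l, ContDiff ℝ 1 (ψ l))
    (hφ : ∀ l p, ‖fderiv ℝ (φ l) p‖ ≤ α)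
    (hψ : ∀ l p, ‖fderiv ℝ (ψ l) p‖ ≤ β)
    (hβ : 1 ≤ β)
    (X : V → EuclideanSpace ℝ (Fin d)) (u v : V) :
    ‖fderiv ℝ (fun y => gnn G d φ ψ r (Function.update X v y) u) (X v)‖ ≤
      (2 * α * β) ^ r * ((max (G.degree u) (G.degree v) : ℝ) / 2) *
        ((2 / (min (G.degree u) (G.degree v) : ℝ)) *
            ((r : ℝ) + 1 + μ ^ (r + 1) / (1 - μ)) - effRes G u v) := by
  have hα : 0 ≤ α := (norm_nonneg _).trans (hφ 0 0)
  have hβ0 : 0 ≤ β := zero_le_one.trans hβ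
  have hφL (l : ℕ) (p q) : ‖φ l p - φ l q‖ ≤ α * ‖p - q‖ :=
    convex_univ.norm_image_sub_le_of_norm_fderiv_le
      (fun x _ => ((hφdiff l).differentiable one_ne_zero) x) (fun x _ => hφ l x)
      (Set.mem_univ q) (Set.mem_univ p)
  have hψL (l : ℕ) (p q) : ‖ψ l p - ψ l q‖ ≤ β * ‖p - q‖ :=
    convex_univ.norm_image_sub_le_of_norm_fderiv_le
      (fun x _ => ((hψdiff l).differentiable one_ne_zero) x) (fun x _ => hψ l x)
      (Set.mem_univ q) (Set.mem_univ p)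
  set S : ℝ := ∑ k ∈ range (r + 1), (nadj G ^ k) u v with hS
  have hS0 : 0 ≤ S := sum_nonneg fun k _ => pow_apply_nonneg (nadj_nonneg G) k u v
  have hfderiv : ‖fderiv ℝ (fun y => gnn G d φ ψ r (Function.update X v y) u) (X v)‖ ≤
      (2 * α * β) ^ r * S := by
    refine norm_fderiv_le_of_lip' ℝ (by positivity) (Filter.Eventually.of_forall fun y => ?_)
    refine (norm_gnn_update_sub_le G hφL hψL hα hβ X v y (X v) r u).trans
      (mul_le_mul_of_nonneg_right ?_ (norm_nonneg _))
    calc _ ≤ (α * β) ^ r * (2 ^ r * S) :=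
          mul_le_mul_of_nonneg_left (one_add_pow_apply_le (nadj_nonneg G) r u v) (by positivity)
      _ = _ := by rw [mul_assoc 2, mul_pow 2]; ring
  refine hfderiv.trans ?_
  rw [mul_assoc (_ ^ _)]
  refine mul_le_mul_of_nonneg_left ?_ (by positivity)
  have hdu : (0 : ℝ) < G.degree u := mod_cast degree_pos hconn hcard u
  have hdv : (0 : ℝ) < G.degree v := mod_cast degree_pos hconn hcard v
  have hsum := sum_pow_nadj_le hconn hcard hμ0 hμ1 hspec r u v
  rw [← hS] at hsum
  set a : ℝ := (G.degree u : ℝ)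
  set b : ℝ := (G.degree v : ℝ)
  have hmin : 0 < min a b := lt_min hdu hdv
  have hmax : 0 < max a b := hdu.trans_le (le_max_left _ _)
  have hinv : a⁻¹ + b⁻¹ ≤ 2 / min a b := by
    have h1 : a⁻¹ ≤ (min a b)⁻¹ := inv_anti₀ hmin (min_le_left _ _)
    have h2 : b⁻¹ ≤ (min a b)⁻¹ := inv_anti₀ hmin (min_le_right _ _)
    rw [div_eq_mul_inv]
    linarith
  have hT : 0 ≤ (r : ℝ) + 1 + μ ^ (r + 1) / (1 - μ) :=
    add_nonneg (by positivity) (div_nonneg (by positivity) (by linarith))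
  have hsqrt : √a * √b ≤ max a b := by
    calc √a * √b ≤ √(max a b) * √(max a b) := by
          gcongr
          · exact le_max_left _ _
          · exact le_max_right _ _
      _ = max a b := Real.mul_self_sqrt hmax.le
  have hab : 0 < √a * √b := mul_pos (Real.sqrt_pos.2 hdu) (Real.sqrt_pos.2 hdv)
  calc S = max a b / 2 * (2 / max a b * S) := by field_simp
    _ ≤ max a b / 2 * (2 / (√a * √b) * S) := by gcongr
    _ ≤ max a b / 2 * ((a⁻¹ + b⁻¹) * ((r : ℝ) + 1 + μ ^ (r + 1) / (1 - μ)) - effRes G u v) := by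
        gcongr
    _ ≤ _ := by gcongr
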